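/- arXiv:0806.0050 — 3 statements merged into one kernel-verified Lean document; each statement's English description precedes it below -/
import Mathlib

section
/- For every N ≥ 1, the maximum possible dimension of a doubly even binary linear code in (ZMod 2)^N equals ϰ(N): every doubly even linear code in (ZMod 2)^N has dimension at most ϰ(N), and there exists a doubly even linear code in (ZMod 2)^N of dimension exactly ϰ(N). -/
/-- The weight of a vector in `(ZMod 2)^N`: the number of coordinates equal to `1`. -/
def wt {N : ℕ} (v : Fin N → ZMod 2) : ℕ :=
  (Finset.univ.filter (fun i => v i = 1)).card

/-- The function `ϰ`: `ϰ(N) = 0` for `N < 4`, `ϰ(4) = ϰ(5) = 1`, `ϰ(6) = 2`, `ϰ(7) = 3`,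
and `ϰ(N) = 4 + ϰ(N - 8)` for `N ≥ 8`. -/
def kappa : ℕ → ℕ
  | 0 => 0
  | 1 => 0
  | 2 => 0
  | 3 => 0
  | 4 => 1
  | 5 => 1
  | 6 => 2
  | 7 => 3
  | (n + 8) => 4 + kappa n

open Complex Module

/-- The nontrivial additive character of `ZMod 2`. -/
noncomputable def signChar : AddChar (ZMod 2) ℂ :=
  AddChar.zmodChar 2 (show (-1 : ℂ) ^ 2 = 1 by norm_num)

lemma signChar_one : signChar 1 = -1 := by
  simp [signChar, AddChar.zmodChar_apply, ZMod.val_one]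

lemma ZMod.eq_zero_or_eq_one_of_two (x : ZMod 2) : x = 0 ∨ x = 1 := by
  revert x; decide

lemma eq_zero_of_signChar_eq_one {x : ZMod 2} (h : signChar x = 1) : x = 0 := by
  rcases x.eq_zero_or_eq_one_of_two with rfl | rfl
  · rfl
  · norm_num [signChar_one] at h

lemma signChar_sum {ι : Type*} (s : Finset ι) (f : ι → ZMod 2) :
    signChar (∑ i ∈ s, f i) = ∏ i ∈ s, signChar (f i) :=
  map_prod signChar.toMonoidHom (fun i => Multiplicative.ofAdd (f i)) s

/-- The form `(v, w) ↦ ∑ i, v i * w i` on `(ZMod 2)^N`. -/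
def dotForm (N : ℕ) : LinearMap.BilinForm (ZMod 2) (Fin N → ZMod 2) :=
  dotProductBilin (ZMod 2) (ZMod 2)

lemma dotForm_apply {N : ℕ} (v w : Fin N → ZMod 2) : dotForm N v w = v ⬝ᵥ w := rfl

lemma dotForm_nondegenerate (N : ℕ) : (dotForm N).Nondegenerate := by
  constructor
  · intro v hv
    exact dotProduct_eq_zero v hv
  · intro v hv
    exact dotProduct_eq_zero v fun w => by rw [dotProduct_comm]; exact hv w

lemma I_pow_wt_eq_prod {N : ℕ} (v : Fin N → ZMod 2) :
    I ^ wt v = ∏ i, if v i = 1 then I else 1 := by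
  simp [wt, Finset.prod_ite]

lemma I_pow_wt_add {N : ℕ} (v w : Fin N → ZMod 2) :
    I ^ wt (v + w) = I ^ wt v * I ^ wt w * signChar (dotForm N w v) := by
  rw [dotForm_apply, dotProduct, signChar_sum]
  simp only [I_pow_wt_eq_prod, ← Finset.prod_mul_distrib, Pi.add_apply]
  refine Finset.prod_congr rfl fun i _ => ?_
  rcases (v i).eq_zero_or_eq_one_of_two with h | h <;>
    rcases (w i).eq_zero_or_eq_one_of_two with h' | h' <;>
    simp [h, h', signChar_one, show (1 + 1 : ZMod 2) = 0 from rfl]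

lemma I_pow_eq_one_of_four_dvd {n : ℕ} (h : 4 ∣ n) : I ^ n = 1 := by
  obtain ⟨k, rfl⟩ := h
  rw [pow_mul, I_pow_four, one_pow]

lemma sum_I_pow_wt (N : ℕ) : ∑ v : Fin N → ZMod 2, I ^ wt v = (1 + I) ^ N := by
  have h := Finset.prod_univ_sum (fun _ : Fin N => (Finset.univ : Finset (ZMod 2)))
    (fun _ x => if x = 1 then I else 1)
  have h2 : ∑ x : ZMod 2, (if x = 1 then I else (1 : ℂ)) = 1 + I := by
    rw [show (Finset.univ : Finset (ZMod 2)) = {0, 1} from rfl]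
    simp
  simp only [h2, Finset.prod_const, Finset.card_univ, Fintype.card_fin,
    Fintype.piFinset_univ] at h
  rw [h]
  exact Finset.sum_congr rfl fun v _ => I_pow_wt_eq_prod v

lemma le_orthogonal_of_doublyEven {N : ℕ} {C : Submodule (ZMod 2) (Fin N → ZMod 2)}
    (hC : ∀ c ∈ C, 4 ∣ wt c) : C ≤ (dotForm N).orthogonal C := by
  intro v hv w hw
  have h := I_pow_wt_add v w
  rw [I_pow_eq_one_of_four_dvd (hC _ (C.add_mem hv hw)), I_pow_eq_one_of_four_dvd (hC _ hv),
    I_pow_eq_one_of_four_dvd (hC _ hw), one_mul, one_mul] at h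
  exact eq_zero_of_signChar_eq_one h.symm

open Classical in
lemma sum_signChar_dotForm {N : ℕ} (C : Submodule (ZMod 2) (Fin N → ZMod 2))
    (v : Fin N → ZMod 2) :
    ∑ c : C, signChar (dotForm N c v) =
      if v ∈ (dotForm N).orthogonal C then (Fintype.card C : ℂ) else 0 := by
  let f : C →ₗ[ZMod 2] ZMod 2 := (dotForm N).flip v ∘ₗ C.subtype
  have h := AddChar.sum_eq_ite (signChar.compAddMonoidHom f.toAddMonoidHom)
  have hiff : signChar.compAddMonoidHom f.toAddMonoidHom = 0 ↔
      v ∈ (dotForm N).orthogonal C := by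
    constructor
    · intro h0 c hc
      exact eq_zero_of_signChar_eq_one (DFunLike.congr_fun h0 (⟨c, hc⟩ : C))
    · intro hv
      ext c
      have : f c = 0 := hv c c.2
      simp [this]
  rw [← if_congr hiff rfl rfl, ← h]
  rfl

open Classical in
/-- For a doubly even code the Gauss sum is supported on the dual code. -/
lemma sum_orthogonal_I_pow_wt {N : ℕ} {C : Submodule (ZMod 2) (Fin N → ZMod 2)}
    (hC : ∀ c ∈ C, 4 ∣ wt c) :
    ∑ v with v ∈ (dotForm N).orthogonal C, I ^ wt v = (1 + I) ^ N := by
  have hcard : (Fintype.card C : ℂ) ≠ 0 := by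
    exact_mod_cast Fintype.card_ne_zero
  apply mul_left_cancel₀ hcard
  calc (Fintype.card C : ℂ) * ∑ v with v ∈ (dotForm N).orthogonal C, I ^ wt v
      = ∑ v, I ^ wt v * ∑ c : C, signChar (dotForm N c v) := by
        simp only [sum_signChar_dotForm, Finset.mul_sum, Finset.sum_filter, mul_ite, mul_zero]
        simp only [mul_comm]
    _ = ∑ c : C, ∑ v : Fin N → ZMod 2, I ^ wt (v + (c : Fin N → ZMod 2)) := by
        simp only [Finset.mul_sum]
        rw [Finset.sum_comm]
        refine Finset.sum_congr rfl fun c _ => Finset.sum_congr rfl fun v _ => ?_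
        rw [I_pow_wt_add, I_pow_eq_one_of_four_dvd (hC c c.2), mul_one]
    _ = ∑ c : C, ∑ v : Fin N → ZMod 2, I ^ wt v := by
        refine Finset.sum_congr rfl fun c _ => ?_
        exact Equiv.sum_comp (Equiv.addRight (c : Fin N → ZMod 2)) fun v => I ^ wt v
    _ = Fintype.card C * (1 + I) ^ N := by simp [sum_I_pow_wt]

open Classical in
lemma card_filter_mem_eq {N : ℕ} (W : Submodule (ZMod 2) (Fin N → ZMod 2)) :
    (Finset.univ.filter (· ∈ W)).card = 2 ^ finrank (ZMod 2) W := by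
  rw [← Fintype.card_subtype]
  exact (Module.card_eq_pow_finrank (K := ZMod 2) (V := W)).trans (by rw [ZMod.card])

lemma re_I_pow_ge (n : ℕ) : -1 ≤ (I ^ n).re := by
  have h := abs_re_le_norm (I ^ n)
  rw [norm_pow, norm_I, one_pow] at h
  exact (abs_le.mp h).1

lemma two_mul_finrank_le_of_doublyEven {N : ℕ} {C : Submodule (ZMod 2) (Fin N → ZMod 2)}
    (hC : ∀ c ∈ C, 4 ∣ wt c) : 2 * finrank (ZMod 2) C ≤ N := by
  have h1 := Submodule.finrank_mono (le_orthogonal_of_doublyEven hC)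
  have h2 := C.finrank_le
  rw [LinearMap.BilinForm.finrank_orthogonal (dotForm_nondegenerate N)] at h1
  rw [finrank_fin_fun] at h1 h2
  omega

open Classical in
lemma re_one_add_I_pow_ge_of_doublyEven {N : ℕ} {C : Submodule (ZMod 2) (Fin N → ZMod 2)}
    (hC : ∀ c ∈ C, 4 ∣ wt c) :
    2 * 2 ^ finrank (ZMod 2) C - 2 ^ (N - finrank (ZMod 2) C) ≤ ((1 + I) ^ N).re := by
  have hle := le_orthogonal_of_doublyEven hC
  rw [← sum_orthogonal_I_pow_wt hC, re_sum]
  have hterm : ∀ v ∈ Finset.univ.filter (· ∈ (dotForm N).orthogonal C),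
      (2 * (if v ∈ C then 1 else 0) - 1 : ℝ) ≤ (I ^ wt v).re := by
    intro v _
    split_ifs with hv
    · rw [I_pow_eq_one_of_four_dvd (hC v hv)]
      norm_num
    · linarith [re_I_pow_ge (wt v)]
  refine le_trans (le_of_eq ?_) (Finset.sum_le_sum hterm)
  rw [Finset.sum_sub_distrib, ← Finset.mul_sum, Finset.sum_boole, Finset.filter_filter,
    Finset.sum_const, card_filter_mem_eq,
    LinearMap.BilinForm.finrank_orthogonal (dotForm_nondegenerate N), finrank_fin_fun]
  simp only [and_iff_right_of_imp (@hle _)]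
  rw [card_filter_mem_eq]
  simp

lemma kappa_eight_mul_add (q r : ℕ) : kappa (8 * q + r) = 4 * q + kappa r := by
  induction q with
  | zero => simp
  | succ q ih =>
    rw [show 8 * (q + 1) + r = 8 * q + r + 8 by ring, kappa, ih]
    ring

lemma one_add_I_sq : (1 + I) ^ 2 = 2 * I := by
  linear_combination I_sq

lemma re_one_add_I_pow (q r : ℕ) :
    ((1 + I) ^ (8 * q + r)).re = 16 ^ q * ((1 + I) ^ r).re := by
  have h8 : (1 + I) ^ 8 = ((16 : ℝ) : ℂ) := by
    rw [show 8 = 2 * 4 from rfl, pow_mul, one_add_I_sq, mul_pow, I_pow_four]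
    norm_num
  rw [pow_add, pow_mul, h8, ← ofReal_pow, re_ofReal_mul]

theorem finrank_le_kappa_of_doublyEven {N : ℕ} {C : Submodule (ZMod 2) (Fin N → ZMod 2)}
    (hC : ∀ c ∈ C, 4 ∣ wt c) : finrank (ZMod 2) C ≤ kappa N := by
  have hdim := two_mul_finrank_le_of_doublyEven hC
  have hre := re_one_add_I_pow_ge_of_doublyEven hC
  generalize finrank (ZMod 2) C = k at hdim hre
  have hodd : N ≤ 2 * k + 1 → 0 ≤ ((1 + I) ^ N).re := by
    intro h
    have : (2 : ℝ) ^ (N - k) ≤ 2 ^ (k + 1) := pow_le_pow_right₀ one_le_two (by omega)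
    rw [pow_succ] at this
    linarith
  have heven : N = 2 * k → 0 < ((1 + I) ^ N).re := by
    rintro rfl
    rw [show 2 * k - k = k by omega] at hre
    have : (0 : ℝ) < 2 ^ k := by positivity
    linarith
  obtain ⟨q, r, hr, rfl⟩ : ∃ q r, r < 8 ∧ N = 8 * q + r :=
    ⟨N / 8, N % 8, Nat.mod_lt _ (by norm_num), (Nat.div_add_mod N 8).symm⟩
  have hpos : (0 : ℝ) < 16 ^ q := by positivity
  rw [re_one_add_I_pow] at hodd heven
  rw [mul_nonneg_iff_of_pos_left hpos] at hodd
  rw [mul_pos_iff_of_pos_left hpos] at heven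
  rw [kappa_eight_mul_add]
  interval_cases r <;> simp only [kappa] <;> by_contra! hk <;>
    first
    | omega
    | have := heven (by omega)
      norm_num [pow_succ] at this
    | have := hodd (by omega)
      norm_num [pow_succ] at this

lemma exists_doublyEven_of_matrix {k N : ℕ} (G : Matrix (Fin k) (Fin N) (ZMod 2))
    (hwt : ∀ x, 4 ∣ wt (Matrix.vecMul x G)) (hker : ∀ x, Matrix.vecMul x G = 0 → x = 0) :
    ∃ C : Submodule (ZMod 2) (Fin N → ZMod 2),
      (∀ c ∈ C, 4 ∣ wt c) ∧ finrank (ZMod 2) C = k := by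
  refine ⟨LinearMap.range G.vecMulLinear, ?_, ?_⟩
  · rintro _ ⟨x, rfl⟩
    exact hwt x
  · rw [LinearMap.finrank_range_of_inj, finrank_fin_fun]
    exact (injective_iff_map_eq_zero _).mpr hker

lemma wt_eq_sum {N : ℕ} (v : Fin N → ZMod 2) : wt v = ∑ i, if v i = 1 then 1 else 0 := by
  simp [wt]

lemma wt_append {m n : ℕ} (v : Fin m → ZMod 2) (w : Fin n → ZMod 2) :
    wt (Fin.append v w) = wt v + wt w := by
  simp only [wt_eq_sum, Fin.sum_univ_add, Fin.append_left, Fin.append_right]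

lemma exists_doublyEven_add {m n k l : ℕ}
    (hm : ∃ C : Submodule (ZMod 2) (Fin m → ZMod 2),
      (∀ c ∈ C, 4 ∣ wt c) ∧ finrank (ZMod 2) C = k)
    (hn : ∃ C : Submodule (ZMod 2) (Fin n → ZMod 2),
      (∀ c ∈ C, 4 ∣ wt c) ∧ finrank (ZMod 2) C = l) :
    ∃ C : Submodule (ZMod 2) (Fin (m + n) → ZMod 2),
      (∀ c ∈ C, 4 ∣ wt c) ∧ finrank (ZMod 2) C = k + l := by
  obtain ⟨C, hC, rfl⟩ := hm
  obtain ⟨D, hD, rfl⟩ := hn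
  let e : ((Fin m → ZMod 2) × (Fin n → ZMod 2)) ≃ₗ[ZMod 2] (Fin (m + n) → ZMod 2) :=
    (LinearEquiv.sumArrowLequivProdArrow _ _ (ZMod 2) _).symm ≪≫ₗ
      LinearEquiv.funCongrLeft (ZMod 2) (ZMod 2) finSumFinEquiv.symm
  have he : ∀ v w, e (v, w) = Fin.append v w := by
    intro v w
    ext i
    refine Fin.addCases (fun i => ?_) (fun i => ?_) i <;>
      simp [e, LinearEquiv.funCongrLeft_apply, LinearMap.funLeft_apply]
  refine ⟨LinearMap.range (e.toLinearMap ∘ₗ C.subtype.prodMap D.subtype), ?_, ?_⟩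
  · rintro _ ⟨⟨v, w⟩, rfl⟩
    change 4 ∣ wt (e (v, w))
    rw [he, wt_append]
    exact dvd_add (hC v v.2) (hD w w.2)
  · rw [LinearMap.finrank_range_of_inj, finrank_prod]
    exact e.injective.comp
      (Function.Injective.prodMap C.injective_subtype D.injective_subtype)

/-- The extended binary Hamming code, and its shortenings, attain the bound in small length. -/
theorem exists_doublyEven_finrank_eq_kappa (N : ℕ) :
    ∃ C : Submodule (ZMod 2) (Fin N → ZMod 2),
      (∀ c ∈ C, 4 ∣ wt c) ∧ finrank (ZMod 2) C = kappa N := by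
  match N with
  | 0 | 1 | 2 | 3 => exact ⟨⊥, by simp [wt], by simp [kappa]⟩
  | 4 => exact exists_doublyEven_of_matrix !![1, 1, 1, 1] (by decide +kernel) (by decide +kernel)
  | 5 =>
    exact exists_doublyEven_of_matrix !![1, 1, 1, 1, 0] (by decide +kernel) (by decide +kernel)
  | 6 =>
    exact exists_doublyEven_of_matrix !![1, 1, 1, 1, 0, 0; 0, 0, 1, 1, 1, 1]
      (by decide +kernel) (by decide +kernel)
  | 7 =>
    exact exists_doublyEven_of_matrix
      !![1, 1, 1, 1, 0, 0, 0; 0, 0, 1, 1, 1, 1, 0; 0, 1, 0, 1, 0, 1, 1]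
      (by decide +kernel) (by decide +kernel)
  | n + 8 =>
    rw [kappa, add_comm 4]
    exact exists_doublyEven_add (exists_doublyEven_finrank_eq_kappa n)
      (exists_doublyEven_of_matrix
        !![1, 1, 1, 1, 0, 0, 0, 0; 0, 0, 1, 1, 1, 1, 0, 0; 0, 0, 0, 0, 1, 1, 1, 1;
          0, 1, 0, 1, 0, 1, 0, 1]
        (by decide +kernel) (by decide +kernel))

/-- For every `N ≥ 1`, the maximum dimension of a doubly even binary linear code of
length `N` is exactly `ϰ(N)`. -/
theorem max_doublyEven_dim {N : ℕ} (hN : 1 ≤ N) :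
    (∀ C : Submodule (ZMod 2) (Fin N → ZMod 2),
        (∀ c ∈ C, 4 ∣ wt c) → Module.finrank (ZMod 2) C ≤ kappa N) ∧
    (∃ C : Submodule (ZMod 2) (Fin N → ZMod 2),
        (∀ c ∈ C, 4 ∣ wt c) ∧ Module.finrank (ZMod 2) C = kappa N) := by
  exact ⟨fun _ hC => finrank_le_kappa_of_doublyEven hC, exists_doublyEven_finrank_eq_kappa N⟩
end

section
/- There are exactly 30 doubly even binary linear codes of length 8 and dimension 4: the set of 4-dimensional ℤ/2-linear subspaces of (ZMod 2)^8 all of whose elements have weight divisible by 4 has cardinality 30. -/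
/-- The vector with support `{3, …, 7} \ {3 + x}`. -/
def kernelWord (x : Fin 5) : Fin 8 → ZMod 2 :=
  Fin.append (m := 3) (n := 5) 0 (fun k => if k = x then 0 else 1)

/-- The vector which is the `i`-th unit vector on the first three coordinates, and on the last five
coordinates vanishes exactly at `x + 1` and `x + 2 + j` (cyclically). -/
def unitWord (x : Fin 5) (i j : Fin 3) : Fin 8 → ZMod 2 :=
  Fin.append (m := 3) (n := 5) (Pi.single i 1)
    (fun k => if k = x + 1 ∨ k = x + 2 + j.castLE (by decide) then 0 else 1)

/-- The linear map with rows `kernelWord x` and `unitWord x i (s i)`. -/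
def encode (x : Fin 5) (s : Fin 3 → Fin 3) : (Fin 4 → ZMod 2) →ₗ[ZMod 2] (Fin 8 → ZMod 2) :=
  Fintype.linearCombination (ZMod 2)
    (Fin.cons (kernelWord x) (fun i => unitWord x i (s i)) : Fin 4 → Fin 8 → ZMod 2)

theorem encode_apply (x : Fin 5) (s : Fin 3 → Fin 3) (a : Fin 4 → ZMod 2) :
    encode x s a = a 0 • kernelWord x + a 1 • unitWord x 0 (s 0) + a 2 • unitWord x 1 (s 1)
      + a 3 • unitWord x 2 (s 2) := by
  simp only [encode, Fintype.linearCombination_apply, Fin.sum_univ_succ]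
  simp [Fin.cons, add_assoc]
  rfl

theorem eq_kernelWord_of_four_dvd_wt (v : Fin 8 → ZMod 2) (hv : v ≠ 0) (h0 : v 0 = 0)
    (h1 : v 1 = 0) (h2 : v 2 = 0) (hw : 4 ∣ wt v) : ∃ x, v = kernelWord x := by
  revert v
  decide +kernel

theorem eq_of_four_dvd_wt_kernelWord_add (x y : Fin 5)
    (h : 4 ∣ wt (kernelWord x + kernelWord y)) : x = y := by
  revert x y
  decide +kernel

theorem eq_unitWord_of_four_dvd_wt (x : Fin 5) (i : Fin 3) (v : Fin 8 → ZMod 2)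
    (h : ∀ k : Fin 3, v (k.castLE (by decide)) = (Pi.single i 1 : Fin 3 → ZMod 2) k)
    (hx : v (Fin.natAdd 3 (x + 1)) = 0)
    (hv : 4 ∣ wt v) (hw : 4 ∣ wt (v + kernelWord x)) : ∃ j, v = unitWord x i j := by
  revert x i v
  decide +kernel

theorem eq_of_four_dvd_wt_unitWord_add (x : Fin 5) (i i' j : Fin 3)
    (h : 4 ∣ wt (unitWord x i j + unitWord x i' j)) : i = i' := by
  revert x i i' j
  decide +kernel

theorem eq_of_four_dvd_wt_unitWord_add' (x : Fin 5) (i j j' : Fin 3)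
    (h : 4 ∣ wt (unitWord x i j + unitWord x i j')) : j = j' := by
  revert x i j j'
  decide +kernel

theorem four_dvd_wt_combination (x : Fin 5) (j₀ j₁ j₂ : Fin 3) (h₀₁ : j₀ ≠ j₁) (h₀₂ : j₀ ≠ j₂)
    (h₁₂ : j₁ ≠ j₂) (a b c d : ZMod 2) :
    4 ∣ wt (a • kernelWord x + b • unitWord x 0 j₀ + c • unitWord x 1 j₁
      + d • unitWord x 2 j₂) := by
  revert x j₀ j₁ j₂ a b c d
  decide +kernel

theorem combination_eq_zero (x : Fin 5) (j₀ j₁ j₂ : Fin 3) (a b c d : ZMod 2)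
    (h : a • kernelWord x + b • unitWord x 0 j₀ + c • unitWord x 1 j₁
      + d • unitWord x 2 j₂ = 0) : a = 0 ∧ b = 0 ∧ c = 0 ∧ d = 0 := by
  revert x j₀ j₁ j₂ a b c d
  decide +kernel

theorem encode_injective (x : Fin 5) (s : Fin 3 → Fin 3) : Function.Injective (encode x s) := by
  rw [injective_iff_map_eq_zero]
  intro a ha
  rw [encode_apply] at ha
  obtain ⟨h0, h1, h2, h3⟩ := combination_eq_zero _ _ _ _ _ _ _ _ ha
  ext k
  fin_cases k <;> assumption

theorem finrank_range_encode (x : Fin 5) (s : Fin 3 → Fin 3) :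
    Module.finrank (ZMod 2) (LinearMap.range (encode x s)) = 4 := by
  rw [LinearMap.finrank_range_of_inj (encode_injective x s)]
  simp

theorem four_dvd_wt_of_mem_range_encode (x : Fin 5) {s : Fin 3 → Fin 3}
    (hs : Function.Injective s) {v : Fin 8 → ZMod 2} (hv : v ∈ LinearMap.range (encode x s)) :
    4 ∣ wt v := by
  obtain ⟨a, rfl⟩ := hv
  rw [encode_apply]
  exact four_dvd_wt_combination _ _ _ _ (hs.ne (by decide)) (hs.ne (by decide))
    (hs.ne (by decide)) _ _ _ _

theorem range_encode_le {x : Fin 5} {s : Fin 3 → Fin 3} {C : Submodule (ZMod 2) (Fin 8 → ZMod 2)} :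
    LinearMap.range (encode x s) ≤ C ↔ kernelWord x ∈ C ∧ ∀ i, unitWord x i (s i) ∈ C := by
  rw [encode, Fintype.range_linearCombination, Submodule.span_le, Set.range_subset_iff,
    Fin.forall_fin_succ]
  simp

theorem exists_range_encode_eq (C : Submodule (ZMod 2) (Fin 8 → ZMod 2))
    (hC : Module.finrank (ZMod 2) C = 4) (hwt : ∀ c ∈ C, 4 ∣ wt c) :
    ∃ (x : Fin 5) (s : Fin 3 → Fin 3), Function.Injective s ∧
      LinearMap.range (encode x s) = C := by
  let π : C →ₗ[ZMod 2] (Fin 3 → ZMod 2) :=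
    (LinearMap.funLeft (ZMod 2) (ZMod 2) (Fin.castLE (by decide : 3 ≤ 8))).comp C.subtype
  have hrn := π.finrank_range_add_finrank_ker
  have hle := (LinearMap.range π).finrank_le
  simp only [hC, Module.finrank_fin_fun] at hrn hle
  have hker : ∀ c ∈ LinearMap.ker π, c ≠ 0 → ∃ x, (c : Fin 8 → ZMod 2) = kernelWord x := by
    intro c hc hc0
    have h := congrFun (LinearMap.mem_ker.1 hc)
    exact eq_kernelWord_of_four_dvd_wt c (by simpa using hc0) (h 0) (h 1) (h 2) (hwt c c.2)
  obtain ⟨w, hw, hw0⟩ : ∃ w ∈ LinearMap.ker π, w ≠ 0 := by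
    refine (Submodule.ne_bot_iff _).1 fun h => ?_
    rw [h, finrank_bot] at hrn
    omega
  obtain ⟨x, hx⟩ := hker w hw hw0
  have hxC : kernelWord x ∈ C := hx ▸ w.2
  have hone : Module.finrank (ZMod 2) (LinearMap.ker π) ≤ 1 := by
    refine finrank_le_one ⟨w, hw⟩ fun c => ?_
    by_cases hc : c = 0
    · exact ⟨0, by simp [hc]⟩
    · obtain ⟨y, hy⟩ := hker c c.2 (by simpa using hc)
      have hyC : kernelWord y ∈ C := hy ▸ c.1.2
      obtain rfl := eq_of_four_dvd_wt_kernelWord_add x y (hwt _ (C.add_mem hxC hyC))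
      exact ⟨1, by rw [one_smul]; exact Subtype.ext (Subtype.ext (hx.trans hy.symm))⟩
  have hsurj : Function.Surjective π := by
    rw [← LinearMap.range_eq_top]
    apply Submodule.eq_top_of_finrank_eq
    rw [Module.finrank_fin_fun]
    omega
  have hunit : ∀ i : Fin 3, ∃ j, unitWord x i j ∈ C := by
    intro i
    have hnorm : ∃ c : C, π c = Pi.single i 1 ∧ (c : Fin 8 → ZMod 2) (Fin.natAdd 3 (x + 1)) = 0 := by
      obtain ⟨c, hc⟩ := hsurj (Pi.single i 1)
      by_cases h : (c : Fin 8 → ZMod 2) (Fin.natAdd 3 (x + 1)) = 0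
      · exact ⟨c, hc, h⟩
      · refine ⟨c + w, by rw [map_add, hc, LinearMap.mem_ker.1 hw, add_zero], ?_⟩
        have hp : ∀ y : Fin 5, kernelWord y (Fin.natAdd 3 (y + 1)) = 1 := by decide
        rw [Submodule.coe_add, Pi.add_apply, hx, hp x, Fin.eq_one_of_ne_zero _ h]
        rfl
    obtain ⟨c, hc, h⟩ := hnorm
    obtain ⟨j, hj⟩ := eq_unitWord_of_four_dvd_wt x i c (congrFun hc) h (hwt c c.2)
      (hwt _ (C.add_mem c.2 hxC))
    exact ⟨j, hj ▸ c.2⟩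
  choose s hs using hunit
  refine ⟨x, s, fun i i' h => ?_, ?_⟩
  · exact eq_of_four_dvd_wt_unitWord_add x i i' (s i)
      (hwt _ (C.add_mem (hs i) (h ▸ hs i')))
  · exact Submodule.eq_of_le_of_finrank_eq (range_encode_le.2 ⟨hxC, hs⟩)
      ((finrank_range_encode x s).trans hC.symm)

theorem range_encode_inj {x x' : Fin 5} {s s' : Fin 3 → Fin 3} (hs : Function.Injective s)
    (h : LinearMap.range (encode x s) = LinearMap.range (encode x' s')) : x = x' ∧ s = s' := by
  obtain ⟨hx, hu⟩ := range_encode_le.1 (le_refl (LinearMap.range (encode x s)))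
  obtain ⟨hx', hu'⟩ := range_encode_le.1 h.ge
  obtain rfl := eq_of_four_dvd_wt_kernelWord_add x x'
    (four_dvd_wt_of_mem_range_encode x hs (Submodule.add_mem _ hx hx'))
  exact ⟨rfl, funext fun i => eq_of_four_dvd_wt_unitWord_add' x i _ _
    (four_dvd_wt_of_mem_range_encode x hs (Submodule.add_mem _ (hu i) (hu' i)))⟩

/-- There are exactly 30 doubly even binary linear codes of length 8 and dimension 4. -/
theorem card_doublyEven_len8_dim4 :
    Nat.card {C : Submodule (ZMod 2) (Fin 8 → ZMod 2) //
      Module.finrank (ZMod 2) C = 4 ∧ ∀ c ∈ C, 4 ∣ wt c} = 30 := by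
  let f : Fin 5 × (Fin 3 ↪ Fin 3) → {C : Submodule (ZMod 2) (Fin 8 → ZMod 2) //
      Module.finrank (ZMod 2) C = 4 ∧ ∀ c ∈ C, 4 ∣ wt c} := fun p =>
    ⟨LinearMap.range (encode p.1 p.2), finrank_range_encode _ _,
      fun _ hc => four_dvd_wt_of_mem_range_encode _ p.2.injective hc⟩
  have hf : Function.Bijective f := by
    constructor
    · rintro ⟨x, s⟩ ⟨x', s'⟩ h
      obtain ⟨hx, hs⟩ := range_encode_inj s.injective (congrArg Subtype.val h)
      exact Prod.ext hx (DFunLike.coe_injective hs)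
    · rintro ⟨C, hC, hwt⟩
      obtain ⟨x, s, hs, h⟩ := exists_range_encode_eq C hC hwt
      exact ⟨(x, ⟨s, hs⟩), Subtype.ext h⟩
  rw [← Nat.card_eq_of_bijective f hf, Nat.card_eq_fintype_card, Fintype.card_prod,
    Fintype.card_embedding_eq]
  rfl
end

section
/- The automorphism group of the code e_8 has order 1344: the set of permutations σ of the 8 coordinate positions such that permuting the coordinates of every codeword of e_8 by σ again yields a codeword of e_8 forms a group of cardinality 1344. -/
/-- The code `e₈ ⊆ (ZMod 2)^8`, spanned by 11110000, 00111100, 00001111, 10101010. -/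
def e8 : Submodule (ZMod 2) (Fin 8 → ZMod 2) :=
  Submodule.span (ZMod 2)
    {![1,1,1,1,0,0,0,0], ![0,0,1,1,1,1,0,0], ![0,0,0,0,1,1,1,1], ![1,0,1,0,1,0,1,0]}

/-- The general affine group of `V` is, as a set, the product of `GL(V)` and the translations. -/
def affineEquivEquivProd (k V : Type*) [Ring k] [AddCommGroup V] [Module k V] :
    (V ≃ᵃ[k] V) ≃ (V ≃ₗ[k] V) × V where
  toFun e := (e.linear, e 0)
  invFun p := p.1.toAffineEquiv.trans (AffineEquiv.constVAdd k V p.2)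
  left_inv e := by
    ext x
    simpa [add_comm] using (e.map_vadd 0 x).symm
  right_inv p := by
    ext x
    · rfl
    · simp

theorem card_affineEquiv_zmod_two :
    Nat.card ((Fin 3 → ZMod 2) ≃ᵃ[ZMod 2] (Fin 3 → ZMod 2)) = 1344 := by
  rw [Nat.card_congr (affineEquivEquivProd _ _), Nat.card_prod,
    ← Nat.card_congr (Matrix.GeneralLinearGroup.toLin.trans
      (LinearMap.GeneralLinearGroup.generalLinearEquiv (ZMod 2) (Fin 3 → ZMod 2))).toEquiv,
    Matrix.card_GL_field]
  simp [Fin.prod_univ_succ, ZMod.card]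

/-- The coordinate positions of `e₈`, labelled by the points of affine 3-space over `ZMod 2`. -/
def e8Point : Fin 8 → Fin 3 → ZMod 2 :=
  fun i => ![![1,1,1,1,0,0,0,0] i, ![0,0,1,1,1,1,0,0] i, ![1,0,1,0,1,0,1,0] i]

theorem e8Point_bijective : Function.Bijective e8Point := by
  decide

/-- The codewords of `e₈` are the affine functions on the affine 3-space of positions. -/
theorem mem_e8_iff (v : Fin 8 → ZMod 2) :
    v ∈ e8 ↔ ∃ f : (Fin 3 → ZMod 2) →ᵃ[ZMod 2] ZMod 2, v = f ∘ e8Point := by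
  constructor
  · intro hv
    induction hv using Submodule.span_induction with
    | mem x hx =>
      have coord {w : Fin 8 → ZMod 2} (j : Fin 3) (hw : w = fun i => e8Point i j) :
          ∃ f : (Fin 3 → ZMod 2) →ᵃ[ZMod 2] ZMod 2, w = f ∘ e8Point :=
        ⟨(LinearMap.proj (R := ZMod 2) (φ := fun _ : Fin 3 => ZMod 2) j).toAffineMap, hw⟩
      rcases hx with rfl | rfl | rfl | rfl
      · exact coord 0 (by decide)
      · exact coord 1 (by decide)
      · refine ⟨AffineMap.const _ _ 1 + (LinearMap.proj 0).toAffineMap, ?_⟩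
        ext i
        fin_cases i <;> decide
      · exact coord 2 (by decide)
    | zero => exact ⟨0, rfl⟩
    | add x y _ _ hx hy =>
      obtain ⟨f, rfl⟩ := hx
      obtain ⟨g, rfl⟩ := hy
      exact ⟨f + g, rfl⟩
    | smul a x _ hx =>
      obtain ⟨f, rfl⟩ := hx
      exact ⟨a • f, rfl⟩
  · rintro ⟨f, rfl⟩
    have key : f ∘ e8Point =
        (f.linear (Pi.single 0 1) + f 0) • ![1,1,1,1,0,0,0,0] +
        f.linear (Pi.single 1 1) • ![0,0,1,1,1,1,0,0] +
        f 0 • ![0,0,0,0,1,1,1,1] +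
        f.linear (Pi.single 2 1) • ![1,0,1,0,1,0,1,0] := by
      have hf (x : Fin 3 → ZMod 2) : f x = x 0 * f.linear (Pi.single 0 1) +
          x 1 * f.linear (Pi.single 1 1) + x 2 * f.linear (Pi.single 2 1) + f 0 := by
        have hs (j : Fin 3) : (fun k => if j = k then 1 else 0) = Pi.single j (1 : ZMod 2) := by
          ext k
          simp [Pi.single_apply, eq_comm]
        rw [congrFun f.decomp x, Pi.add_apply, LinearMap.pi_apply_eq_sum_univ f.linear x]
        simp [Fin.sum_univ_three, hs]
      ext i
      rw [Function.comp_apply, hf]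
      fin_cases i <;> simp [e8Point] <;> ring
    rw [key]
    refine add_mem (add_mem (add_mem ?_ ?_) ?_) ?_ <;>
      exact Submodule.smul_mem _ _ (Submodule.subset_span (by simp))

/-- The action of affine transformations on the coordinate positions. -/
noncomputable def affineToPerm :
    ((Fin 3 → ZMod 2) ≃ᵃ[ZMod 2] (Fin 3 → ZMod 2)) →* Equiv.Perm (Fin 8) :=
  (Equiv.ofBijective e8Point e8Point_bijective).symm.permCongrHom.toMonoidHom.comp
    { toFun := AffineEquiv.toEquiv, map_one' := rfl, map_mul' := fun _ _ => rfl }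

theorem e8Point_affineToPerm (A : (Fin 3 → ZMod 2) ≃ᵃ[ZMod 2] (Fin 3 → ZMod 2)) (i : Fin 8) :
    e8Point (affineToPerm A i) = A (e8Point i) :=
  let φ := Equiv.ofBijective e8Point e8Point_bijective
  φ.apply_symm_apply (A (φ i))

theorem affineToPerm_injective : Function.Injective affineToPerm := by
  intro A B h
  ext1 x
  obtain ⟨i, rfl⟩ := e8Point_bijective.surjective x
  rw [← e8Point_affineToPerm, h, e8Point_affineToPerm]

theorem mem_range_affineToPerm_iff (σ : Equiv.Perm (Fin 8)) :
    σ ∈ affineToPerm.range ↔ ∀ v ∈ e8, v ∘ σ ∈ e8 := by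
  simp only [mem_e8_iff]
  constructor
  · rintro ⟨A, rfl⟩ _ ⟨f, rfl⟩
    exact ⟨f.comp A.toAffineMap, funext fun i => congrArg f (e8Point_affineToPerm A i)⟩
  · intro h
    choose f hf using fun j : Fin 3 => h _ ⟨(LinearMap.proj j).toAffineMap, rfl⟩
    have hA (i : Fin 8) : AffineMap.pi f (e8Point i) = e8Point (σ i) :=
      funext fun j => (congrFun (hf j) i).symm
    have hbij : Function.Bijective (AffineMap.pi f) := by
      rw [← Function.Bijective.of_comp_iff _ e8Point_bijective,
        show AffineMap.pi f ∘ e8Point = e8Point ∘ σ from funext hA]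
      exact e8Point_bijective.comp σ.bijective
    refine ⟨AffineEquiv.ofBijective hbij, Equiv.ext fun i => e8Point_bijective.injective ?_⟩
    rw [e8Point_affineToPerm]
    exact hA i

/-- The permutations of the 8 coordinate positions which carry the set of codewords of
`e₈` onto itself form a group of order 1344. -/
theorem aut_e8_card :
    ∃ G : Subgroup (Equiv.Perm (Fin 8)),
      (∀ σ : Equiv.Perm (Fin 8), σ ∈ G ↔ ∀ v ∈ e8, v ∘ σ ∈ e8) ∧
      Nat.card G = 1344 := by
  refine ⟨affineToPerm.range, mem_range_affineToPerm_iff, ?_⟩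
  rw [← card_affineEquiv_zmod_two]
  exact (Nat.card_congr (affineToPerm.ofInjective affineToPerm_injective).toEquiv).symm
end
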